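/- Let m ≥ 2, let G : ℝ^m → (symmetric positive-definite m×m real matrices) be smooth, and let γ : ℝ × [0,t₀) → ℝ^m be a curve shortening flow in local coordinates with respect to G (so ∂ₓγ ≠ 0 everywhere and ∂_t γ = H, where H = ∇_T T is the mean curvature vector). Then at every point (x,t) one has ∇_t T − ∇_T H = |A|² T, where |A|² = ⟨H,H⟩_G. (Since ∂_tγ = H, the left-hand side is ∇_H T − ∇_T H.) -/

import Mathlib

open scoped BigOperators

noncomputable section

/-- Inner product of two vectors with respect to a metric matrix `G`. -/
def minner {m : ℕ} (G : Matrix (Fin m) (Fin m) ℝ) (u v : Fin m → ℝ) : ℝ :=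
  ∑ α, ∑ β, u α * G α β * v β

/-- Norm of a vector with respect to a metric matrix `G`. -/
def mnorm {m : ℕ} (G : Matrix (Fin m) (Fin m) ℝ) (v : Fin m → ℝ) : ℝ :=
  Real.sqrt (minner G v v)

/-- Christoffel symbols `Γ^α_{βγ}` of the metric `G` at the point `p`:
`Γ^α_{βγ} = (1/2) Σ_δ (G⁻¹)^{αδ}(∂_β G_{δγ} + ∂_γ G_{δβ} − ∂_δ G_{βγ})`. -/
def christoffel {m : ℕ} (G : (Fin m → ℝ) → Matrix (Fin m) (Fin m) ℝ)
    (p : Fin m → ℝ) (α β γ : Fin m) : ℝ :=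
  (1 / 2) * ∑ δ, (G p)⁻¹ α δ *
      (fderiv ℝ (fun q => G q δ γ) p (Pi.single β 1)
        + fderiv ℝ (fun q => G q δ β) p (Pi.single γ 1)
        - fderiv ℝ (fun q => G q β γ) p (Pi.single δ 1))

/-- Unit tangent vector `T = ∂ₓc/|∂ₓc|_G` of a curve `c` with respect to the metric `G`. -/
def unitT {m : ℕ} (G : (Fin m → ℝ) → Matrix (Fin m) (Fin m) ℝ)
    (c : ℝ → Fin m → ℝ) (x : ℝ) : Fin m → ℝ :=
  (mnorm (G (c x)) (deriv c x))⁻¹ • deriv c x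

/-- Covariant derivative `∇_T V` of a vector field `V` along the curve `c`. -/
def covT {m : ℕ} (G : (Fin m → ℝ) → Matrix (Fin m) (Fin m) ℝ)
    (c V : ℝ → Fin m → ℝ) (x : ℝ) : Fin m → ℝ :=
  fun α => (mnorm (G (c x)) (deriv c x))⁻¹ *
    (deriv (fun y => V y α) x
      + ∑ β, ∑ δ, christoffel G (c x) α β δ * deriv c x β * V x δ)

/-- Mean curvature vector `H = ∇_T T` of the curve `c`. -/
def meanCurv {m : ℕ} (G : (Fin m → ℝ) → Matrix (Fin m) (Fin m) ℝ)
    (c : ℝ → Fin m → ℝ) : ℝ → Fin m → ℝ :=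
  covT G c (unitT G c)

/-- Directional derivative `T(η) = |∂ₓc|⁻¹ ∂ₓη` of a scalar function along the curve `c`. -/
def Tscal {m : ℕ} (G : (Fin m → ℝ) → Matrix (Fin m) (Fin m) ℝ)
    (c : ℝ → Fin m → ℝ) (η : ℝ → ℝ) (x : ℝ) : ℝ :=
  (mnorm (G (c x)) (deriv c x))⁻¹ * deriv η x

/-- Laplacian `Δη = T(T(η))` along the curve `c`. -/
def lapScal {m : ℕ} (G : (Fin m → ℝ) → Matrix (Fin m) (Fin m) ℝ)
    (c : ℝ → Fin m → ℝ) (η : ℝ → ℝ) : ℝ → ℝ :=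
  Tscal G c (Tscal G c η)

/-- Time covariant derivative `∇_t V` along a flow `γ`. -/
def covTime {m : ℕ} (G : (Fin m → ℝ) → Matrix (Fin m) (Fin m) ℝ)
    (γ V : ℝ → ℝ → Fin m → ℝ) (x t : ℝ) : Fin m → ℝ :=
  fun α => deriv (fun s => V x s α) t
    + ∑ β, ∑ δ, christoffel G (γ x t) α β δ * deriv (fun s => γ x s β) t * V x t δ

/-- Left warped product metric `g + ψ²(x) dr²` on `ℝ^{1+n}` (index 0 is the circle direction). -/
def gwL {n : ℕ} (g : (Fin n → ℝ) → Matrix (Fin n) (Fin n) ℝ)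
    (ψ : (Fin n → ℝ) → ℝ) (p : Fin (n + 1) → ℝ) : Matrix (Fin (n + 1)) (Fin (n + 1)) ℝ :=
  Matrix.of fun α β =>
    Fin.cases (Fin.cases ((ψ fun i => p i.succ) ^ 2) (fun _ => 0) β)
      (fun i => Fin.cases 0 (fun j => g (fun k => p k.succ) i j) β) α

/-- Right warped product metric `φ²(r) g + dr²` on `ℝ^{1+n}` (index 0 is the circle direction). -/
def gwR {n : ℕ} (g : (Fin n → ℝ) → Matrix (Fin n) (Fin n) ℝ)
    (φ : ℝ → ℝ) (p : Fin (n + 1) → ℝ) : Matrix (Fin (n + 1)) (Fin (n + 1)) ℝ :=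
  Matrix.of fun α β =>
    Fin.cases (Fin.cases 1 (fun _ => 0) β)
      (fun i => Fin.cases 0 (fun j => (φ (p 0)) ^ 2 * g (fun k => p k.succ) i j) β) α

/-- The vector `∂r = e₀` in `ℝ^{1+n}`. -/
def er (n : ℕ) : Fin (n + 1) → ℝ := Pi.single 0 1

/-- The gradient `D(log ψ)` of `log ψ` with respect to `(N, g)`, as a vector in `ℝ^{1+n}`
with vanishing 0-th component. -/
def DlogPsi {n : ℕ} (g : (Fin n → ℝ) → Matrix (Fin n) (Fin n) ℝ)
    (ψ : (Fin n → ℝ) → ℝ) (x : Fin n → ℝ) : Fin (n + 1) → ℝ :=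
  Fin.cases 0 (fun i => ∑ k, (g x)⁻¹ i k *
    fderiv ℝ (fun y => Real.log (ψ y)) x (Pi.single k 1))

/-- `|D(log ψ)|² = Σ_{k,l} (g⁻¹)^{kl} ∂_k(log ψ) ∂_l(log ψ)`. -/
def normSqDlogPsi {n : ℕ} (g : (Fin n → ℝ) → Matrix (Fin n) (Fin n) ℝ)
    (ψ : (Fin n → ℝ) → ℝ) (x : Fin n → ℝ) : ℝ :=
  ∑ k, ∑ l, (g x)⁻¹ k l *
    fderiv ℝ (fun y => Real.log (ψ y)) x (Pi.single k 1) *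
    fderiv ℝ (fun y => Real.log (ψ y)) x (Pi.single l 1)

/-- `∇_X ∂r` at the point `p`, i.e. `(∇_X ∂r)^α = Σ_β X^β Γ^α_{β0}`. -/
def covR {m : ℕ} [NeZero m] (G : (Fin m → ℝ) → Matrix (Fin m) (Fin m) ℝ)
    (p : Fin m → ℝ) (X : Fin m → ℝ) : Fin m → ℝ :=
  fun α => ∑ β, X β * christoffel G p α β 0

/-- The angle function `Θ_L = ⟨T, ∂r⟩_{G_L}` of a flow `γ` in the left warped product. -/
def thetaL {n : ℕ} (g : (Fin n → ℝ) → Matrix (Fin n) (Fin n) ℝ)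
    (ψ : (Fin n → ℝ) → ℝ) (γ : ℝ → ℝ → Fin (n + 1) → ℝ) (x t : ℝ) : ℝ :=
  minner (gwL g ψ (γ x t)) (unitT (gwL g ψ) (fun y => γ y t) x) (er n)

/-- The angle function `Θ_R = ⟨T, ∂r⟩_{G_R}` of a flow `γ` in the right warped product. -/
def thetaR {n : ℕ} (g : (Fin n → ℝ) → Matrix (Fin n) (Fin n) ℝ)
    (φ : ℝ → ℝ) (γ : ℝ → ℝ → Fin (n + 1) → ℝ) (x t : ℝ) : ℝ :=
  minner (gwR g φ (γ x t)) (unitT (gwR g φ) (fun y => γ y t) x) (er n)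

/-- The bilinear Christoffel term `Γ^α_{βδ} u^β v^δ` of the metric `G` at `p`. -/
def christoffelTerm {m : ℕ} (G : (Fin m → ℝ) → Matrix (Fin m) (Fin m) ℝ)
    (p u v : Fin m → ℝ) : Fin m → ℝ :=
  fun α => ∑ β, ∑ δ, christoffel G p α β δ * u β * v δ

section Algebra

variable {m : ℕ} (A : Matrix (Fin m) (Fin m) ℝ)

lemma minner_add_left (u v w : Fin m → ℝ) :
    minner A (u + v) w = minner A u w + minner A v w := by
  simp only [minner, Pi.add_apply, add_mul, Finset.sum_add_distrib]

lemma minner_add_right (u v w : Fin m → ℝ) :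
    minner A u (v + w) = minner A u v + minner A u w := by
  simp only [minner, Pi.add_apply, mul_add, Finset.sum_add_distrib]

lemma minner_smul_left (r : ℝ) (u v : Fin m → ℝ) :
    minner A (r • u) v = r * minner A u v := by
  simp only [minner, Pi.smul_apply, smul_eq_mul, Finset.mul_sum, mul_assoc]

lemma minner_smul_right (r : ℝ) (u v : Fin m → ℝ) :
    minner A u (r • v) = r * minner A u v := by
  simp only [minner, Pi.smul_apply, smul_eq_mul, Finset.mul_sum]
  refine Finset.sum_congr rfl fun _ _ => Finset.sum_congr rfl fun _ _ => ?_
  ring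

variable {A}

lemma minner_comm (hA : ∀ α β, A α β = A β α) (u v : Fin m → ℝ) :
    minner A u v = minner A v u := by
  unfold minner
  rw [Finset.sum_comm]
  refine Finset.sum_congr rfl fun a _ => Finset.sum_congr rfl fun b _ => ?_
  rw [hA b a]
  ring

lemma minner_self_pos (hA : A.PosDef) {v : Fin m → ℝ} (hv : v ≠ 0) : 0 < minner A v v := by
  have h := hA.dotProduct_mulVec_pos hv
  simpa [minner, dotProduct, Matrix.mulVec, Finset.mul_sum, mul_assoc] using h

lemma mnorm_mul_self (hA : A.PosDef) {v : Fin m → ℝ} (hv : v ≠ 0) :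
    mnorm A v * mnorm A v = minner A v v :=
  Real.mul_self_sqrt (minner_self_pos hA hv).le

lemma mnorm_pos (hA : A.PosDef) {v : Fin m → ℝ} (hv : v ≠ 0) : 0 < mnorm A v :=
  Real.sqrt_pos.2 (minner_self_pos hA hv)

end Algebra

section Connection

variable {m : ℕ} {G : (Fin m → ℝ) → Matrix (Fin m) (Fin m) ℝ}

lemma metric_symm (hGpd : ∀ p, (G p).PosDef) (p : Fin m → ℝ) (α β : Fin m) :
    G p α β = G p β α := by
  simpa using (hGpd p).isHermitian.apply β α

lemma christoffel_symm (hsymm : ∀ p α β, G p α β = G p β α) (p : Fin m → ℝ) (α β δ : Fin m) :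
    christoffel G p α β δ = christoffel G p α δ β := by
  unfold christoffel
  congr 1
  refine Finset.sum_congr rfl fun ε _ => ?_
  simp only [hsymm _ β δ]
  ring

lemma christoffelTerm_comm (hsymm : ∀ p α β, G p α β = G p β α) (p u v : Fin m → ℝ) :
    christoffelTerm G p u v = christoffelTerm G p v u := by
  funext α
  unfold christoffelTerm
  rw [Finset.sum_comm]
  refine Finset.sum_congr rfl fun β _ => Finset.sum_congr rfl fun δ _ => ?_
  rw [christoffel_symm hsymm p α δ β]
  ring

lemma christoffelTerm_smul_right (p u v : Fin m → ℝ) (r : ℝ) :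
    christoffelTerm G p u (r • v) = r • christoffelTerm G p u v := by
  funext α
  simp only [christoffelTerm, Pi.smul_apply, smul_eq_mul, Finset.mul_sum]
  refine Finset.sum_congr rfl fun β _ => Finset.sum_congr rfl fun δ _ => ?_
  ring

/-- Lowering the upper index of the Christoffel symbols. -/
lemma sum_metric_mul_christoffel {p : Fin m → ℝ} (hp : IsUnit (G p).det) (ε β δ : Fin m) :
    ∑ α, G p ε α * christoffel G p α β δ =
      (1 / 2) * (fderiv ℝ (fun q => G q ε δ) p (Pi.single β 1)
        + fderiv ℝ (fun q => G q ε β) p (Pi.single δ 1)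
        - fderiv ℝ (fun q => G q β δ) p (Pi.single ε 1)) := by
  set D : Fin m → ℝ := fun ε => fderiv ℝ (fun q => G q ε δ) p (Pi.single β 1)
    + fderiv ℝ (fun q => G q ε β) p (Pi.single δ 1)
    - fderiv ℝ (fun q => G q β δ) p (Pi.single ε 1) with hD
  have h : (G p).mulVec ((G p)⁻¹.mulVec D) = D := by
    rw [Matrix.mulVec_mulVec, Matrix.mul_nonsing_inv _ hp, Matrix.one_mulVec]
  have hε := congrFun h ε
  change _ = (1 / 2) * D ε
  rw [← hε]
  simp only [Matrix.mulVec, dotProduct, christoffel, Finset.mul_sum, hD]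
  refine Finset.sum_congr rfl fun _ _ => Finset.sum_congr rfl fun _ _ => ?_
  ring

lemma minner_christoffelTerm_left (hsymm : ∀ p α β, G p α β = G p β α) {p : Fin m → ℝ}
    (hp : IsUnit (G p).det) (u v w : Fin m → ℝ) :
    minner (G p) (christoffelTerm G p u v) w =
      ∑ ε, ∑ δ, ∑ β, (1 / 2) * (fderiv ℝ (fun q => G q ε δ) p (Pi.single β 1)
        + fderiv ℝ (fun q => G q ε β) p (Pi.single δ 1)
        - fderiv ℝ (fun q => G q β δ) p (Pi.single ε 1)) * u β * v δ * w ε := by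
  simp only [← sum_metric_mul_christoffel hp, minner, christoffelTerm, Finset.sum_mul]
  rw [Finset.sum_comm]
  refine Finset.sum_congr rfl fun ε _ => ?_
  conv_rhs => rw [Finset.sum_comm]
  rw [Finset.sum_comm]
  refine Finset.sum_congr rfl fun β _ => ?_
  rw [Finset.sum_comm]
  refine Finset.sum_congr rfl fun δ _ => Finset.sum_congr rfl fun α _ => ?_
  rw [hsymm p α ε]
  ring

lemma minner_christoffelTerm_add (hsymm : ∀ p α β, G p α β = G p β α) {p : Fin m → ℝ}
    (hp : IsUnit (G p).det) (u v w : Fin m → ℝ) :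
    minner (G p) (christoffelTerm G p u v) w + minner (G p) v (christoffelTerm G p u w) =
      ∑ ε, ∑ δ, fderiv ℝ (fun q => G q ε δ) p u * v ε * w δ := by
  have hu (ε δ : Fin m) : fderiv ℝ (fun q => G q ε δ) p u =
      ∑ β, fderiv ℝ (fun q => G q ε δ) p (Pi.single β 1) * u β := by
    conv_lhs => rw [pi_eq_sum_univ' u]
    simp only [map_sum, map_smul, smul_eq_mul, mul_comm]
  rw [minner_comm (hsymm p) v, minner_christoffelTerm_left hsymm hp,
    minner_christoffelTerm_left hsymm hp, Finset.sum_comm]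
  simp only [hu, ← Finset.sum_add_distrib, Finset.sum_mul]
  refine Finset.sum_congr rfl fun ε _ => Finset.sum_congr rfl fun δ _ =>
    Finset.sum_congr rfl fun β _ => ?_
  simp only [hsymm _ δ ε, hsymm _ δ β, hsymm _ ε β]
  ring

/-- The Levi-Civita covariant derivative along a curve is compatible with the metric. -/
lemma hasDerivAt_minner (hG : ∀ α β, Differentiable ℝ fun p => G p α β)
    (hsymm : ∀ p α β, G p α β = G p β α) {c V W : ℝ → Fin m → ℝ} {c' V' W' : Fin m → ℝ} {s : ℝ}
    (hp : IsUnit (G (c s)).det) (hc : HasDerivAt c c' s) (hV : HasDerivAt V V' s)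
    (hW : HasDerivAt W W' s) :
    HasDerivAt (fun y => minner (G (c y)) (V y) (W y))
      (minner (G (c s)) (V' + christoffelTerm G (c s) c' (V s)) (W s)
        + minner (G (c s)) (V s) (W' + christoffelTerm G (c s) c' (W s))) s := by
  have hterm (α β : Fin m) : HasDerivAt (fun y => V y α * G (c y) α β * W y β)
      ((V' α * G (c s) α β + V s α * fderiv ℝ (fun q => G q α β) (c s) c') * W s β
        + V s α * G (c s) α β * W' β) s :=
    (((hasDerivAt_pi.1 hV α).mul
      ((hG α β (c s)).hasFDerivAt.comp_hasDerivAt s hc)).mul (hasDerivAt_pi.1 hW β))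
  have h := HasDerivAt.fun_sum (u := Finset.univ) fun α _ =>
    HasDerivAt.fun_sum (u := Finset.univ) fun β _ => hterm α β
  refine h.congr_deriv ?_
  rw [minner_add_left, minner_add_right, add_add_add_comm, minner_christoffelTerm_add hsymm hp]
  simp only [minner, ← Finset.sum_add_distrib]
  refine Finset.sum_congr rfl fun ε _ => Finset.sum_congr rfl fun δ _ => ?_
  ring

lemma covT_eq_of_hasDerivAt {c V : ℝ → Fin m → ℝ} {V' : Fin m → ℝ} {x : ℝ}
    (hV : HasDerivAt V V' x) :
    covT G c V x = (mnorm (G (c x)) (deriv c x))⁻¹ •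
      (V' + christoffelTerm G (c x) (deriv c x) (V x)) := by
  funext α
  simp [covT, christoffelTerm, (hasDerivAt_pi.1 hV α).deriv]

lemma covTime_eq_of_hasDerivAt {γ V : ℝ → ℝ → Fin m → ℝ} {γ' V' : Fin m → ℝ} {x t : ℝ}
    (hγ : HasDerivAt (γ x) γ' t) (hV : HasDerivAt (V x) V' t) :
    covTime G γ V x t = V' + christoffelTerm G (γ x t) γ' (V x t) := by
  funext α
  have (β : Fin m) : deriv (fun s => γ x s β) t = γ' β := (hasDerivAt_pi.1 hγ β).deriv
  simp [covTime, christoffelTerm, (hasDerivAt_pi.1 hV α).deriv, this]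

end Connection

section Curve

variable {m : ℕ} {G : (Fin m → ℝ) → Matrix (Fin m) (Fin m) ℝ} {c : ℝ → Fin m → ℝ}

lemma minner_unitT_self (hGpd : ∀ p, (G p).PosDef) (hreg : ∀ y, deriv c y ≠ 0) (y : ℝ) :
    minner (G (c y)) (unitT G c y) (unitT G c y) = 1 := by
  have hpos := mnorm_pos (hGpd (c y)) (hreg y)
  rw [unitT, minner_smul_left, minner_smul_right, ← mnorm_mul_self (hGpd (c y)) (hreg y)]
  field_simp

lemma minner_covT_add (hG : ∀ α β, Differentiable ℝ fun p => G p α β)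
    (hGpd : ∀ p, (G p).PosDef) {V W : ℝ → Fin m → ℝ} {x r : ℝ} (hc : DifferentiableAt ℝ c x)
    (hV : DifferentiableAt ℝ V x) (hW : DifferentiableAt ℝ W x)
    (hconst : ∀ y, minner (G (c y)) (V y) (W y) = r) :
    minner (G (c x)) (covT G c V x) (W x) + minner (G (c x)) (V x) (covT G c W x) = 0 := by
  have h := hasDerivAt_minner hG (metric_symm hGpd) (hGpd (c x)).det_pos.ne'.isUnit
    hc.hasDerivAt hV.hasDerivAt hW.hasDerivAt
  simp only [hconst] at h
  rw [covT_eq_of_hasDerivAt hV.hasDerivAt, covT_eq_of_hasDerivAt hW.hasDerivAt,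
    minner_smul_left, minner_smul_right, ← mul_add, h.unique (hasDerivAt_const x r), mul_zero]

/-- The mean curvature vector is normal to the curve. -/
lemma minner_meanCurv_unitT (hG : ∀ α β, Differentiable ℝ fun p => G p α β)
    (hGpd : ∀ p, (G p).PosDef) (hreg : ∀ y, deriv c y ≠ 0) (hc : Differentiable ℝ c)
    (hT : Differentiable ℝ (unitT G c)) (y : ℝ) :
    minner (G (c y)) (meanCurv G c y) (unitT G c y) = 0 := by
  have h := minner_covT_add hG hGpd (hc y) (hT y) (hT y) (minner_unitT_self hGpd hreg)
  rw [minner_comm (metric_symm hGpd (c y)) (unitT G c y)] at h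
  change minner (G (c y)) (covT G c (unitT G c) y) (unitT G c y) = 0
  linarith

/-- `⟨∇_T H, T⟩ = -|H|²` along a regular curve. -/
lemma minner_covT_meanCurv_unitT (hG : ∀ α β, Differentiable ℝ fun p => G p α β)
    (hGpd : ∀ p, (G p).PosDef) (hreg : ∀ y, deriv c y ≠ 0) (hc : Differentiable ℝ c)
    (hT : Differentiable ℝ (unitT G c)) {x : ℝ} (hH : DifferentiableAt ℝ (meanCurv G c) x) :
    minner (G (c x)) (covT G c (meanCurv G c) x) (unitT G c x) =
      -minner (G (c x)) (meanCurv G c x) (meanCurv G c x) :=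
  eq_neg_of_add_eq_zero_left <| minner_covT_add hG hGpd (hc x) hH (hT x)
    (minner_meanCurv_unitT hG hGpd hreg hc hT)

lemma differentiable_unitT (hG : ∀ α β, Differentiable ℝ fun p => G p α β)
    (hGpd : ∀ p, (G p).PosDef) (hreg : ∀ y, deriv c y ≠ 0) (hc : Differentiable ℝ c)
    (hc' : Differentiable ℝ (deriv c)) : Differentiable ℝ (unitT G c) := fun y =>
  (((hasDerivAt_minner hG (metric_symm hGpd) (hGpd (c y)).det_pos.ne'.isUnit (hc y).hasDerivAt
    (hc' y).hasDerivAt (hc' y).hasDerivAt).sqrt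
      (minner_self_pos (hGpd _) (hreg y)).ne').differentiableAt.inv
        (mnorm_pos (hGpd _) (hreg y)).ne').smul (hc' y)

end Curve

/-- The algebraic identity relating the variation of the speed `v` to the curvature `h`. -/
lemma speed_variation_identity {E : Type*} [AddCommGroup E] [Module ℝ E] {v n h : ℝ} {X M K : E}
    (hv : v ≠ 0) (hn : v⁻¹ * (v⁻¹ * n) = -h) :
    v⁻¹ • M + (-((n + n) / (2 * v)) / v ^ 2) • X + v⁻¹ • K - v⁻¹ • (M + K) = h • v⁻¹ • X := by
  have hcoeff : -((n + n) / (2 * v)) / v ^ 2 = h * v⁻¹ := by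
    rw [← neg_neg h, ← hn]
    field_simp
    ring
  rw [hcoeff]
  module

section MixedPartials

variable {E : Type*} [NormedAddCommGroup E] [NormedSpace ℝ E] {γ : ℝ → ℝ → E}

lemma hasDerivAt_fst (hγ : Differentiable ℝ fun q : ℝ × ℝ => γ q.1 q.2) (x t : ℝ) :
    HasDerivAt (fun y => γ y t) (fderiv ℝ (fun q : ℝ × ℝ => γ q.1 q.2) (x, t) (1, 0)) x :=
  (hγ (x, t)).hasFDerivAt.comp_hasDerivAt (f := fun y => (y, t)) x
    ((hasDerivAt_id x).prodMk (hasDerivAt_const x t))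

lemma hasDerivAt_snd (hγ : Differentiable ℝ fun q : ℝ × ℝ => γ q.1 q.2) (x t : ℝ) :
    HasDerivAt (γ x) (fderiv ℝ (fun q : ℝ × ℝ => γ q.1 q.2) (x, t) (0, 1)) t :=
  (hγ (x, t)).hasFDerivAt.comp_hasDerivAt (f := fun s => (x, s)) t
    ((hasDerivAt_const t x).prodMk (hasDerivAt_id t))

/-- The first partial derivatives of a `C²` family are differentiable, and the mixed second
partial derivatives agree. -/
lemma exists_mixed_partial (hγ : ContDiff ℝ 2 fun q : ℝ × ℝ => γ q.1 q.2) (x t : ℝ) :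
    DifferentiableAt ℝ (deriv fun y => γ y t) x ∧
    ∃ M : E, HasDerivAt (fun s => deriv (fun y => γ y s) x) M t ∧
      HasDerivAt (fun y => deriv (γ y) t) M x := by
  have hd : Differentiable ℝ fun q : ℝ × ℝ => γ q.1 q.2 := hγ.differentiable (by norm_num)
  have hd' : Differentiable ℝ (fderiv ℝ fun q : ℝ × ℝ => γ q.1 q.2) :=
    (hγ.fderiv_right (m := 1) (by norm_num)).differentiable (by norm_num)
  have hx (s : ℝ) : (deriv fun y => γ y s) =
      fun y => fderiv ℝ (fun q : ℝ × ℝ => γ q.1 q.2) (y, s) (1, 0) :=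
    funext fun y => (hasDerivAt_fst hd y s).deriv
  have ht (y : ℝ) : deriv (γ y) t = fderiv ℝ (fun q : ℝ × ℝ => γ q.1 q.2) (y, t) (0, 1) :=
    (hasDerivAt_snd hd y t).deriv
  simp only [hx, ht]
  have h1 := hasDerivAt_fst (γ := fun y s => fderiv ℝ (fun q : ℝ × ℝ => γ q.1 q.2) (y, s)) hd' x t
  have h2 := hasDerivAt_snd (γ := fun y s => fderiv ℝ (fun q : ℝ × ℝ => γ q.1 q.2) (y, s)) hd' x t
  refine ⟨(h1.clm_apply (hasDerivAt_const x ((1, 0) : ℝ × ℝ))).differentiableAt, _,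
    (h2.clm_apply (hasDerivAt_const t ((1, 0) : ℝ × ℝ))),
    (h1.clm_apply (hasDerivAt_const x ((0, 1) : ℝ × ℝ))).congr_deriv ?_⟩
  simp only [map_zero, add_zero]
  exact (hγ.contDiffAt.isSymmSndFDerivAt (by simp)) _ _

end MixedPartials

/-- Along a curve shortening flow, `∇_t T − ∇_T H = |A|² T` (Lemma 4 of Ma–Chen). -/
theorem stmt5 {m : ℕ} (hm : 2 ≤ m)
    (G : (Fin m → ℝ) → Matrix (Fin m) (Fin m) ℝ)
    (hG : ∀ α β, ContDiff ℝ (⊤ : ℕ∞) fun p => G p α β)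
    (hGpd : ∀ p, (G p).PosDef)
    (t₀ : ℝ) (γ : ℝ → ℝ → Fin m → ℝ)
    (hγ : ContDiff ℝ (⊤ : ℕ∞) fun q : ℝ × ℝ => γ q.1 q.2)
    (hreg : ∀ x t, deriv (fun y => γ y t) x ≠ 0)
    (hflow : ∀ x : ℝ, ∀ t ∈ Set.Ico (0 : ℝ) t₀,
      deriv (γ x) t = meanCurv G (fun y => γ y t) x)
    (x : ℝ) (t : ℝ) (ht : t ∈ Set.Ico (0 : ℝ) t₀) :
    covTime G γ (fun y s => unitT G (fun y' => γ y' s) y) x t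
        - covT G (fun y => γ y t) (meanCurv G (fun y => γ y t)) x
      = minner (G (γ x t)) (meanCurv G (fun y => γ y t) x) (meanCurv G (fun y => γ y t) x)
          • unitT G (fun y => γ y t) x := by
  have hG' (α β : Fin m) : Differentiable ℝ fun p => G p α β := (hG α β).differentiable (by simp)
  have hγ2 : ContDiff ℝ 2 fun q : ℝ × ℝ => γ q.1 q.2 := hγ.of_le (by norm_cast)
  have hγ1 := hγ2.differentiable (by norm_num)
  set c : ℝ → Fin m → ℝ := fun y => γ y t
  have hc : Differentiable ℝ c := fun y => (hasDerivAt_fst hγ1 y t).differentiableAt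
  have hreg' (y : ℝ) : deriv c y ≠ 0 := hreg y t
  have hT : Differentiable ℝ (unitT G c) := differentiable_unitT hG' hGpd hreg' hc
    fun y => (exists_mixed_partial hγ2 y t).1
  obtain ⟨-, M, hXt, hMx⟩ := exists_mixed_partial hγ2 x t
  have hH : HasDerivAt (meanCurv G c) M x := by
    rwa [show (fun y => deriv (γ y) t) = meanCurv G c from funext fun y => hflow y t ht] at hMx
  have hγt : HasDerivAt (γ x) (meanCurv G c x) t := by
    rw [← hflow x t ht]
    exact (hasDerivAt_snd hγ1 x t).differentiableAt.hasDerivAt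
  have hsymm := metric_symm hGpd
  have hcov := covT_eq_of_hasDerivAt (G := G) (c := c) hH
  have hkey := minner_covT_meanCurv_unitT hG' hGpd hreg' hc hT hH.differentiableAt
  have hspeed := ((hasDerivAt_minner hG' hsymm (hGpd (γ x t)).det_pos.ne'.isUnit hγt hXt hXt).sqrt
    (minner_self_pos (hGpd _) (hreg x t)).ne').inv (mnorm_pos (hGpd _) (hreg x t)).ne'
  have hTt := hspeed.smul hXt
  have hv := mnorm_pos (hGpd (c x)) (hreg' x)
  rw [minner_comm (hsymm _) (deriv (fun y => γ y t) x)] at hTt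
  rw [covTime_eq_of_hasDerivAt hγt (V := fun y s => unitT G (fun y' => γ y' s) y) hTt]
  change _ + _ • deriv c x + christoffelTerm G (c x) _ (unitT G c x) - _ = _
  rw [hcov] at hkey ⊢
  simp only [unitT, minner_smul_left, minner_smul_right] at hkey
  rw [unitT, christoffelTerm_smul_right, christoffelTerm_comm hsymm _ (meanCurv G c x)]
  exact speed_variation_identity hv.ne' hkey

end
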